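/- arXiv:1712.07330 — 6 statements merged into one kernel-verified Lean document; each statement's English description precedes it below -/
import Mathlib

section
/- Let γ = (x, y) : ℝ → ℝ² be a C^∞ curve with y(t) > 0 for all t, and suppose γ'(t) = l(t)(cos φ(t), sin φ(t)) for C^∞ functions l, φ : ℝ → ℝ. Then for every t with l(t) ≠ 0, the mean curvature H(t) = (E·N − 2·F̃·M + G̃·L)/(2(E·G̃ − F̃²)) of the surface of revolution s at (t, θ) (which is independent of θ) satisfies H(t)·l(t) = (1/2)·( l(t)·cos φ(t)/y(t) − φ'(t) ). In particular, the product H·l extends to a C^∞ function on all of ℝ. -/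
open Real

/-- Euclidean dot product on `ℝ × ℝ × ℝ`. -/
noncomputable def dot3 (v w : ℝ × ℝ × ℝ) : ℝ :=
  v.1 * w.1 + v.2.1 * w.2.1 + v.2.2 * w.2.2

/-- For a surface of revolution with frontal profile curve
`γ = (x, y)`, `γ' = l (cos φ, sin φ)`, the mean curvature `H` (computed from the
fundamental forms with respect to the normal `ν`) satisfies
`H l = (1/2) (l cos φ / y − φ')` at regular points; in particular `H l`
extends to a `C^∞` function on all of `ℝ`. -/
theorem meanCurvature_mul_l_of_revolution
    (x y l φ : ℝ → ℝ)
    (hx : ContDiff ℝ (⊤ : ℕ∞) x) (hy : ContDiff ℝ (⊤ : ℕ∞) y) (hl : ContDiff ℝ (⊤ : ℕ∞) l)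
    (hφ : ContDiff ℝ (⊤ : ℕ∞) φ)
    (hypos : ∀ t, 0 < y t)
    (hγ : ∀ t, deriv x t = l t * cos (φ t) ∧ deriv y t = l t * sin (φ t))
    (s : ℝ → ℝ → ℝ × ℝ × ℝ)
    (hs : ∀ t θ, s t θ = (x t, y t * cos θ, y t * sin θ))
    (ν : ℝ → ℝ → ℝ × ℝ × ℝ)
    (hν : ∀ t θ, ν t θ = (sin (φ t), -cos (φ t) * cos θ, -cos (φ t) * sin θ))
    (E Ft Gt L M N H : ℝ → ℝ → ℝ)
    (hE : ∀ t θ, E t θ =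
      dot3 (deriv (fun u => s u θ) t) (deriv (fun u => s u θ) t))
    (hFt : ∀ t θ, Ft t θ =
      dot3 (deriv (fun u => s u θ) t) (deriv (fun v => s t v) θ))
    (hGt : ∀ t θ, Gt t θ =
      dot3 (deriv (fun v => s t v) θ) (deriv (fun v => s t v) θ))
    (hL : ∀ t θ, L t θ =
      dot3 (deriv (fun u => deriv (fun u' => s u' θ) u) t) (ν t θ))
    (hM : ∀ t θ, M t θ =
      dot3 (deriv (fun v => deriv (fun u => s u v) t) θ) (ν t θ))
    (hN : ∀ t θ, N t θ =
      dot3 (deriv (fun v => deriv (fun v' => s t v') v) θ) (ν t θ))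
    (hH : ∀ t θ, H t θ =
      (E t θ * N t θ - 2 * Ft t θ * M t θ + Gt t θ * L t θ) /
        (2 * (E t θ * Gt t θ - Ft t θ ^ 2))) :
    (∀ t θ : ℝ, l t ≠ 0 →
      H t θ * l t = (1 / 2) * (l t * cos (φ t) / y t - deriv φ t)) ∧
    ∃ g : ℝ → ℝ, ContDiff ℝ (⊤ : ℕ∞) g ∧ ∀ t θ : ℝ, l t ≠ 0 → H t θ * l t = g t := by
  have dx : ∀ t, HasDerivAt x (l t * cos (φ t)) t := fun t =>
    (hγ t).1 ▸ (hx.differentiable (by simp) t).hasDerivAt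
  have dy : ∀ t, HasDerivAt y (l t * sin (φ t)) t := fun t =>
    (hγ t).2 ▸ (hy.differentiable (by simp) t).hasDerivAt
  have dl : ∀ t, HasDerivAt l (deriv l t) t := fun t =>
    (hl.differentiable (by simp) t).hasDerivAt
  have dφ : ∀ t, HasDerivAt φ (deriv φ t) t := fun t =>
    (hφ.differentiable (by simp) t).hasDerivAt
  have s_t : ∀ t θ, deriv (fun u => s u θ) t =
      (l t * cos (φ t), l t * sin (φ t) * cos θ, l t * sin (φ t) * sin θ) := fun t θ => by
    simp only [hs]
    exact ((dx t).prodMk (((dy t).mul_const _).prodMk ((dy t).mul_const _))).deriv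
  have s_θ : ∀ t θ, deriv (fun v => s t v) θ = (0, y t * -sin θ, y t * cos θ) := fun t θ => by
    simp only [hs]
    exact ((hasDerivAt_const θ (x t)).prodMk (((hasDerivAt_cos θ).const_mul _).prodMk
      ((hasDerivAt_sin θ).const_mul _))).deriv
  have s_θθ : ∀ t θ, deriv (fun v => deriv (fun v' => s t v') v) θ =
      (0, y t * -cos θ, y t * -sin θ) := fun t θ => by
    simp only [s_θ]
    exact ((hasDerivAt_const θ (0 : ℝ)).prodMk (((hasDerivAt_sin θ).neg.const_mul _).prodMk
      ((hasDerivAt_cos θ).const_mul _))).deriv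
  have s_tt : ∀ t θ, deriv (fun u => deriv (fun u' => s u' θ) u) t =
      (deriv l t * cos (φ t) + l t * (-sin (φ t) * deriv φ t),
        (deriv l t * sin (φ t) + l t * (cos (φ t) * deriv φ t)) * cos θ,
        (deriv l t * sin (φ t) + l t * (cos (φ t) * deriv φ t)) * sin θ) := fun t θ => by
    simp only [s_t]
    have dsin := (dl t).mul (dφ t).sin
    exact (((dl t).mul (dφ t).cos).prodMk ((dsin.mul_const _).prodMk (dsin.mul_const _))).deriv
  have E_eq : ∀ t θ, E t θ = l t ^ 2 := fun t θ => by
    rw [hE, s_t]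
    simp only [dot3]
    linear_combination l t ^ 2 * sin (φ t) ^ 2 * sin_sq_add_cos_sq θ +
      l t ^ 2 * sin_sq_add_cos_sq (φ t)
  have Ft_eq : ∀ t θ, Ft t θ = 0 := fun t θ => by
    rw [hFt, s_t, s_θ]
    simp only [dot3]
    ring
  have Gt_eq : ∀ t θ, Gt t θ = y t ^ 2 := fun t θ => by
    rw [hGt, s_θ]
    simp only [dot3]
    linear_combination y t ^ 2 * sin_sq_add_cos_sq θ
  have L_eq : ∀ t θ, L t θ = -(l t * deriv φ t) := fun t θ => by
    rw [hL, s_tt, hν]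
    simp only [dot3]
    linear_combination
      -(deriv l t * sin (φ t) + l t * (cos (φ t) * deriv φ t)) * cos (φ t) *
        sin_sq_add_cos_sq θ - l t * deriv φ t * sin_sq_add_cos_sq (φ t)
  have N_eq : ∀ t θ, N t θ = y t * cos (φ t) := fun t θ => by
    rw [hN, s_θθ, hν]
    simp only [dot3]
    linear_combination y t * cos (φ t) * sin_sq_add_cos_sq θ
  have key : ∀ t θ : ℝ, l t ≠ 0 →
      H t θ * l t = (1 / 2) * (l t * cos (φ t) / y t - deriv φ t) := fun t θ hlt => by
    have hyt := (hypos t).ne'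
    rw [hH, E_eq, Ft_eq, Gt_eq, L_eq, N_eq]
    simp only [mul_zero, zero_mul, sub_zero, ne_eq, OfNat.ofNat_ne_zero, not_false_eq_true,
      zero_pow]
    field_simp
    ring
  exact ⟨key, _, contDiff_const.mul (((hl.mul hφ.cos).div hy fun t => (hypos t).ne').sub
    (contDiff_infty_iff_deriv.1 hφ).2), key⟩
end

section
/- Let γ = (x, y) : ℝ → ℝ² be C^∞ with y(t) > 0 for all t, γ'(t) = l(t)(cos φ(t), sin φ(t)) for C^∞ functions l, φ, and let h : ℝ → ℝ be a C^∞ function satisfying 2·h(t)·y(t) − l(t)·cos φ(t) + y(t)·φ'(t) = 0 for all t. Then the complex-valued function z(t) = y(t)·sin φ(t) + i·y(t)·cos φ(t) satisfies the linear ODE z'(t) − 2·i·h(t)·z(t) − l(t) = 0 for all t. -/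
open Real

/-- If the profile curve `γ = (x, y)` with `γ' = l (cos φ, sin φ)` satisfies the
prescribed mean curvature equation `2 h y − l cos φ + y φ' = 0` (where `h = H l`),
then `z = y sin φ + i y cos φ` satisfies the linear ODE `z' − 2 i h z − l = 0`. -/
theorem complex_ode_of_mean_curvature_equation
    (x y l φ h : ℝ → ℝ)
    (hx : ContDiff ℝ (⊤ : ℕ∞) x) (hy : ContDiff ℝ (⊤ : ℕ∞) y) (hl : ContDiff ℝ (⊤ : ℕ∞) l)
    (hφ : ContDiff ℝ (⊤ : ℕ∞) φ) (hh : ContDiff ℝ (⊤ : ℕ∞) h)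
    (hypos : ∀ t, 0 < y t)
    (hγ : ∀ t, deriv x t = l t * cos (φ t) ∧ deriv y t = l t * sin (φ t))
    (hmean : ∀ t, 2 * h t * y t - l t * cos (φ t) + y t * deriv φ t = 0)
    (z : ℝ → ℂ)
    (hz : ∀ t, z t = ((y t * sin (φ t) : ℝ) : ℂ)
      + Complex.I * ((y t * cos (φ t) : ℝ) : ℂ)) :
    ∀ t, deriv z t - 2 * Complex.I * (h t : ℂ) * z t - (l t : ℂ) = 0 := by
  intro t
  have hy' : HasDerivAt y (l t * sin (φ t)) t :=
    (hγ t).2 ▸ (hy.differentiable (by simp) t).hasDerivAt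
  have hφ' : HasDerivAt φ (deriv φ t) t := (hφ.differentiable (by simp) t).hasDerivAt
  have hre : HasDerivAt (fun s => y s * sin (φ s)) (l t - 2 * h t * (y t * cos (φ t))) t := by
    refine (hy'.mul hφ'.sin).congr_deriv ?_
    linear_combination cos (φ t) * hmean t + l t * sin_sq_add_cos_sq (φ t)
  have him : HasDerivAt (fun s => y s * cos (φ s)) (2 * h t * (y t * sin (φ t))) t := by
    refine (hy'.mul hφ'.cos).congr_deriv ?_
    linear_combination (-sin (φ t)) * hmean t
  have hz' := hre.ofReal_comp.add (him.ofReal_comp.const_mul Complex.I)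
  rw [(hz'.congr_of_eventuallyEq (.of_forall hz)).deriv, hz t]
  push_cast
  linear_combination
    (-2 * (h t : ℂ) * (y t * Complex.cos (φ t))) * Complex.I_mul_I
end

section
/- For all t ∈ ℝ, the derivative of the curve γ = (x, y) satisfies γ'(t) = (l(t)/y(t))·R_{−η(t)}·U(t); equivalently, x'(t) = (l(t)/y(t))·( sin η(t)·(G(t) − c₂) − cos η(t)·(F(t) − c₁) ) and y'(t) = (l(t)/y(t))·( sin η(t)·(F(t) − c₁) + cos η(t)·(G(t) − c₂) ). -/
open Real

/-- Rotation of the plane by angle `θ`. -/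
noncomputable def rot (θ : ℝ) (v : ℝ × ℝ) : ℝ × ℝ :=
  (Real.cos θ * v.1 - Real.sin θ * v.2, Real.sin θ * v.1 + Real.cos θ * v.2)

/-- Determinant of the 2×2 matrix with columns `v`, `w`. -/
def det2 (v w : ℝ × ℝ) : ℝ := v.1 * w.2 - v.2 * w.1

/-- A primitive of a continuous function, given pointwise as an interval integral, is
differentiable with the expected derivative. -/
theorem hasDerivAt_of_eq_integral {f Φ : ℝ → ℝ} {a : ℝ} (hf : Continuous f)
    (hΦ : ∀ t, Φ t = ∫ u in a..t, f u) (t : ℝ) : HasDerivAt Φ (f t) t := by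
  rw [funext hΦ]
  exact intervalIntegral.integral_hasDerivAt_right (hf.intervalIntegrable _ _)
    (hf.stronglyMeasurableAtFilter _ _) hf.continuousAt

/-- The derivative of the profile curve `γ = (x, y)` is `(l/y) R_{−η} U`. -/
theorem deriv_profile_curve
    (l h : ℝ → ℝ) (hl : ContDiff ℝ (⊤ : ℕ∞) l) (hh : ContDiff ℝ (⊤ : ℕ∞) h)
    (η F G : ℝ → ℝ)
    (hη : ∀ u, η u = ∫ v in (0:ℝ)..u, 2 * h v)
    (hF : ∀ t, F t = ∫ u in (0:ℝ)..t, l u * sin (η u))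
    (hG : ∀ t, G t = ∫ u in (0:ℝ)..t, l u * cos (η u))
    (c₁ c₂ : ℝ)
    (hpos : ∀ t, 0 < (F t - c₁) ^ 2 + (G t - c₂) ^ 2)
    (y x : ℝ → ℝ)
    (hy : ∀ t, y t = Real.sqrt ((F t - c₁) ^ 2 + (G t - c₂) ^ 2))
    (hx : ∀ t, x t = ∫ u in (0:ℝ)..t,
      (deriv F u * (G u - c₂) - deriv G u * (F u - c₁)) / y u)
    (γ : ℝ → ℝ × ℝ) (hγ : ∀ t, γ t = (x t, y t))
    (U : ℝ → ℝ × ℝ) (hU : ∀ t, U t = (-(F t - c₁), G t - c₂))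
    :
    ∀ t, deriv γ t = (l t / y t) • rot (-(η t)) (U t) ∧
      deriv x t = (l t / y t) * (sin (η t) * (G t - c₂) - cos (η t) * (F t - c₁)) ∧
      deriv y t = (l t / y t) * (sin (η t) * (F t - c₁) + cos (η t) * (G t - c₂)) := by
  have hηc : Continuous η := continuous_iff_continuousAt.2 fun u =>
    (hasDerivAt_of_eq_integral (hh.continuous.const_mul 2) hη u).continuousAt
  have hlc : Continuous l := hl.continuous
  have hdF := hasDerivAt_of_eq_integral (hlc.mul (continuous_sin.comp hηc)) hF
  have hdG := hasDerivAt_of_eq_integral (hlc.mul (continuous_cos.comp hηc)) hG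
  have hdF' : ∀ u, deriv F u = l u * sin (η u) := fun u => (hdF u).deriv
  have hdG' : ∀ u, deriv G u = l u * cos (η u) := fun u => (hdG u).deriv
  have hFc : Continuous F := continuous_iff_continuousAt.2 fun u => (hdF u).continuousAt
  have hGc : Continuous G := continuous_iff_continuousAt.2 fun u => (hdG u).continuousAt
  have hyc : Continuous y := by
    rw [funext hy]
    fun_prop
  have hy0 : ∀ t, y t ≠ 0 := fun t => by
    rw [hy t]
    exact (Real.sqrt_pos.2 (hpos t)).ne'
  simp only [hdF', hdG'] at hx
  intro t
  have hdx : HasDerivAt x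
      ((l t / y t) * (sin (η t) * (G t - c₂) - cos (η t) * (F t - c₁))) t := by
    convert hasDerivAt_of_eq_integral (Continuous.div (by fun_prop) hyc hy0) hx t using 1
    simp only [Pi.div_apply]
    ring
  have hdy : HasDerivAt y
      ((l t / y t) * (sin (η t) * (F t - c₁) + cos (η t) * (G t - c₂))) t := by
    have hd := ((((hdF t).sub_const c₁).pow 2).add (((hdG t).sub_const c₂).pow 2)).sqrt
      (hpos t).ne'
    convert hd using 1
    · exact funext hy
    · have hyt := hy t
      simp only [Pi.add_apply, Pi.pow_apply, Pi.mul_apply, Function.comp_apply, ← hyt]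
      have := hy0 t
      field_simp
      ring
  refine ⟨?_, hdx.deriv, hdy.deriv⟩
  rw [funext hγ, (hdx.prodMk hdy).deriv, hU t]
  simp only [rot, cos_neg, sin_neg, Prod.smul_mk, smul_eq_mul, Prod.mk.injEq]
  constructor <;> ring
end

section
/- There exists a C^∞ function φ : ℝ → ℝ such that γ'(t) = l(t)·(cos φ(t), sin φ(t)) for all t ∈ ℝ and such that the prescribed mean curvature equation 2·h(t)·y(t) − l(t)·cos φ(t) + y(t)·φ'(t) = 0 holds for all t ∈ ℝ. (Consequently, at every t with l(t) ≠ 0, the surface of revolution of γ has mean curvature H(t) = h(t)/l(t) with respect to the normal determined by φ.) -/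
open Real

theorem hasDerivAt_intervalIntegral_of_continuous {f : ℝ → ℝ} (hf : Continuous f) (a t : ℝ) :
    HasDerivAt (fun s => ∫ u in a..s, f u) (f t) t :=
  intervalIntegral.integral_hasDerivAt_right (hf.intervalIntegrable _ _)
    (hf.stronglyMeasurableAtFilter _ _) hf.continuousAt

theorem contDiff_intervalIntegral {f : ℝ → ℝ} (hf : ContDiff ℝ (⊤ : ℕ∞) f) (a : ℝ) :
    ContDiff ℝ (⊤ : ℕ∞) (fun s => ∫ u in a..s, f u) := by
  have hd := hasDerivAt_intervalIntegral_of_continuous hf.continuous a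
  refine contDiff_infty_iff_deriv.2 ⟨fun t => (hd t).differentiableAt, ?_⟩
  rwa [show deriv (fun s => ∫ u in a..s, f u) = f from funext fun t => (hd t).deriv]

/-- A smooth plane curve avoiding the origin has a smooth polar angle. -/
theorem exists_contDiff_polar_angle {a b : ℝ → ℝ} (ha : ContDiff ℝ (⊤ : ℕ∞) a)
    (hb : ContDiff ℝ (⊤ : ℕ∞) b) (hpos : ∀ t, 0 < a t ^ 2 + b t ^ 2) :
    ∃ α : ℝ → ℝ, ContDiff ℝ (⊤ : ℕ∞) α ∧
      (∀ t, HasDerivAt α ((a t * deriv b t - b t * deriv a t) / (a t ^ 2 + b t ^ 2)) t) ∧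
      (∀ t, a t = √(a t ^ 2 + b t ^ 2) * cos (α t)) ∧
      (∀ t, b t = √(a t ^ 2 + b t ^ 2) * sin (α t)) := by
  have hω : ContDiff ℝ (⊤ : ℕ∞)
      (fun t => (a t * deriv b t - b t * deriv a t) / (a t ^ 2 + b t ^ 2)) :=
    ((ha.mul (contDiff_infty_iff_deriv.1 hb).2).sub
      (hb.mul (contDiff_infty_iff_deriv.1 ha).2)).div ((ha.pow 2).add (hb.pow 2))
      fun t => (hpos t).ne'
  set α : ℝ → ℝ := fun t => Complex.arg ⟨a 0, b 0⟩ +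
    ∫ u in (0 : ℝ)..t, (a u * deriv b u - b u * deriv a u) / (a u ^ 2 + b u ^ 2) with hα
  have hα' (t : ℝ) :
      HasDerivAt α ((a t * deriv b t - b t * deriv a t) / (a t ^ 2 + b t ^ 2)) t :=
    (hasDerivAt_intervalIntegral_of_continuous hω.continuous 0 t).const_add _
  have hr (t : ℝ) : 0 < √(a t ^ 2 + b t ^ 2) := Real.sqrt_pos.2 (hpos t)
  have hsq (t : ℝ) : √(a t ^ 2 + b t ^ 2) ^ 2 = a t ^ 2 + b t ^ 2 := Real.sq_sqrt (hpos t).le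
  have ha' (t : ℝ) : HasDerivAt a (deriv a t) t :=
    ((contDiff_infty_iff_deriv.1 ha).1 t).hasDerivAt
  have hb' (t : ℝ) : HasDerivAt b (deriv b t) t :=
    ((contDiff_infty_iff_deriv.1 hb).1 t).hasDerivAt
  have hr' (t : ℝ) := (((ha' t).pow 2).add ((hb' t).pow 2)).sqrt (hpos t).ne'
  have hC (t : ℝ) : HasDerivAt
      (fun s => (a s * cos (α s) + b s * sin (α s)) / √(a s ^ 2 + b s ^ 2)) 0 t := by
    refine ((((ha' t).mul (hα' t).cos).add ((hb' t).mul (hα' t).sin)).div (hr' t)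
      (hr t).ne').congr_deriv ?_
    have hsq := hsq t
    have hr := (hr t).ne'
    simp only [Pi.add_apply, Pi.mul_apply, Pi.pow_apply]
    generalize √(a t ^ 2 + b t ^ 2) = r at hsq hr ⊢
    rw [← hsq]
    field_simp
    linear_combination 2 * (deriv a t * cos (α t) + deriv b t * sin (α t)) * hsq
  have hS (t : ℝ) : HasDerivAt
      (fun s => (b s * cos (α s) - a s * sin (α s)) / √(a s ^ 2 + b s ^ 2)) 0 t := by
    refine ((((hb' t).mul (hα' t).cos).sub ((ha' t).mul (hα' t).sin)).div (hr' t)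
      (hr t).ne').congr_deriv ?_
    have hsq := hsq t
    have hr := (hr t).ne'
    simp only [Pi.add_apply, Pi.sub_apply, Pi.mul_apply, Pi.pow_apply]
    generalize √(a t ^ 2 + b t ^ 2) = r at hsq hr ⊢
    rw [← hsq]
    field_simp
    linear_combination 2 * (deriv b t * cos (α t) - deriv a t * sin (α t)) * hsq
  have h0 : α 0 = Complex.arg ⟨a 0, b 0⟩ := by simp [hα]
  have hz : ‖(⟨a 0, b 0⟩ : ℂ)‖ = √(a 0 ^ 2 + b 0 ^ 2) := by
    rw [Complex.norm_eq_sqrt_sq_add_sq]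
  have ha0 : a 0 = √(a 0 ^ 2 + b 0 ^ 2) * cos (α 0) := by
    rw [h0, ← hz, Complex.norm_mul_cos_arg]
  have hb0 : b 0 = √(a 0 ^ 2 + b 0 ^ 2) * sin (α 0) := by
    rw [h0, ← hz, Complex.norm_mul_sin_arg]
  have hC1 (t : ℝ) : a t * cos (α t) + b t * sin (α t) = √(a t ^ 2 + b t ^ 2) := by
    have h := is_const_of_deriv_eq_zero (fun s => (hC s).differentiableAt)
      (fun s => (hC s).deriv) t 0
    have h1 : (a 0 * cos (α 0) + b 0 * sin (α 0)) / √(a 0 ^ 2 + b 0 ^ 2) = 1 := by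
      rw [div_eq_one_iff_eq (hr 0).ne']
      linear_combination cos (α 0) * ha0 + sin (α 0) * hb0 +
        √(a 0 ^ 2 + b 0 ^ 2) * sin_sq_add_cos_sq (α 0)
    exact (div_eq_one_iff_eq (hr t).ne').1 (h.trans h1)
  have hS0 (t : ℝ) : b t * cos (α t) - a t * sin (α t) = 0 := by
    have h := is_const_of_deriv_eq_zero (fun s => (hS s).differentiableAt)
      (fun s => (hS s).deriv) t 0
    have h1 : (b 0 * cos (α 0) - a 0 * sin (α 0)) / √(a 0 ^ 2 + b 0 ^ 2) = 0 := by
      rw [div_eq_zero_iff]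
      left
      linear_combination cos (α 0) * hb0 - sin (α 0) * ha0
    exact (div_eq_zero_iff.1 (h.trans h1)).resolve_right (hr t).ne'
  refine ⟨α, contDiff_const.add (contDiff_intervalIntegral hω 0), hα', fun t => ?_, fun t => ?_⟩
  · linear_combination cos (α t) * hC1 t - sin (α t) * hS0 t - a t * sin_sq_add_cos_sq (α t)
  · linear_combination sin (α t) * hC1 t + cos (α t) * hS0 t - b t * sin_sq_add_cos_sq (α t)

/-- There is a smooth angle function `φ` with `γ' = l (cos φ, sin φ)` satisfying the
prescribed mean curvature equation `2 h y − l cos φ + y φ' = 0`. -/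
theorem exists_angle_function_with_prescribed_mean_curvature
    (l h : ℝ → ℝ) (hl : ContDiff ℝ (⊤ : ℕ∞) l) (hh : ContDiff ℝ (⊤ : ℕ∞) h)
    (η F G : ℝ → ℝ)
    (hη : ∀ u, η u = ∫ v in (0:ℝ)..u, 2 * h v)
    (hF : ∀ t, F t = ∫ u in (0:ℝ)..t, l u * sin (η u))
    (hG : ∀ t, G t = ∫ u in (0:ℝ)..t, l u * cos (η u))
    (c₁ c₂ : ℝ)
    (hpos : ∀ t, 0 < (F t - c₁) ^ 2 + (G t - c₂) ^ 2)
    (y x : ℝ → ℝ)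
    (hy : ∀ t, y t = Real.sqrt ((F t - c₁) ^ 2 + (G t - c₂) ^ 2))
    (hx : ∀ t, x t = ∫ u in (0:ℝ)..t,
      (deriv F u * (G u - c₂) - deriv G u * (F u - c₁)) / y u)
    :
    ∃ φ : ℝ → ℝ, ContDiff ℝ (⊤ : ℕ∞) φ ∧
      (∀ t, deriv x t = l t * cos (φ t) ∧ deriv y t = l t * sin (φ t)) ∧
      (∀ t, 2 * h t * y t - l t * cos (φ t) + y t * deriv φ t = 0) := by
  have hη_eq : η = fun u => ∫ v in (0:ℝ)..u, 2 * h v := funext hη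
  have h2h : ContDiff ℝ (⊤ : ℕ∞) (fun v => 2 * h v) := contDiff_const.mul hh
  have hη_smooth : ContDiff ℝ (⊤ : ℕ∞) η := hη_eq ▸ contDiff_intervalIntegral h2h 0
  have hη' (t : ℝ) : HasDerivAt η (2 * h t) t :=
    hη_eq ▸ hasDerivAt_intervalIntegral_of_continuous h2h.continuous 0 t
  have hls : ContDiff ℝ (⊤ : ℕ∞) (fun u => l u * sin (η u)) := hl.mul hη_smooth.sin
  have hlc : ContDiff ℝ (⊤ : ℕ∞) (fun u => l u * cos (η u)) := hl.mul hη_smooth.cos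
  have hF_smooth : ContDiff ℝ (⊤ : ℕ∞) F := (funext hF : F = _) ▸ contDiff_intervalIntegral hls 0
  have hG_smooth : ContDiff ℝ (⊤ : ℕ∞) G := (funext hG : G = _) ▸ contDiff_intervalIntegral hlc 0
  have hF' (t : ℝ) : HasDerivAt F (l t * sin (η t)) t :=
    (funext hF : F = _) ▸ hasDerivAt_intervalIntegral_of_continuous hls.continuous 0 t
  have hG' (t : ℝ) : HasDerivAt G (l t * cos (η t)) t :=
    (funext hG : G = _) ▸ hasDerivAt_intervalIntegral_of_continuous hlc.continuous 0 t
  obtain ⟨α, hα, hα', hcos, hsin⟩ := exists_contDiff_polar_angle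
    (hF_smooth.sub contDiff_const) (hG_smooth.sub contDiff_const) hpos
  simp only [← hy, deriv_sub_const_fun, (hF' _).deriv, (hG' _).deriv] at hα' hcos hsin
  have hy_pos (t : ℝ) : 0 < y t := hy t ▸ Real.sqrt_pos.2 (hpos t)
  have hy_sq (t : ℝ) : y t ^ 2 = (F t - c₁) ^ 2 + (G t - c₂) ^ 2 := by
    rw [hy, Real.sq_sqrt (hpos t).le]
  simp only [← hy_sq] at hα'
  have hx_integrand (u : ℝ) : (deriv F u * (G u - c₂) - deriv G u * (F u - c₁)) / y u =
      l u * cos (π - (α u + η u)) := by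
    rw [(hF' u).deriv, (hG' u).deriv, hsin, hcos, cos_pi_sub, cos_add,
      div_eq_iff (hy_pos u).ne']
    ring
  simp only [hx_integrand] at hx
  have hφ : ContDiff ℝ (⊤ : ℕ∞) (fun t => π - (α t + η t)) :=
    contDiff_const.sub (hα.add hη_smooth)
  refine ⟨fun t => π - (α t + η t), hφ, fun t => ⟨?_, ?_⟩, fun t => ?_⟩
  · rw [funext hx]
    exact (hasDerivAt_intervalIntegral_of_continuous
      (hl.mul hφ.cos).continuous 0 t).deriv
  · rw [funext hy]
    refine (((((hF' t).sub_const c₁).pow 2).add (((hG' t).sub_const c₂).pow 2)).sqrt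
      (hpos t).ne').deriv.trans ?_
    simp only [Pi.add_apply, Pi.pow_apply, ← hy]
    rw [hsin, hcos, sin_pi_sub, sin_add]
    have := (hy_pos t).ne'
    field_simp
    ring
  · have hd := (((hα' t).add (hη' t)).const_sub π).deriv
    simp only [Pi.add_apply] at hd
    rw [hd, hsin, hcos, cos_pi_sub, cos_add]
    have := (hy_pos t).ne'
    field_simp
    ring
end

section
/- Suppose l(p) = 0. Then n'(p) ≠ 0 if and only if η'(p) ≠ 0 (equivalently, h(p) ≠ 0). In other words, at a singular point p of γ, the frontal γ is a front if and only if η'(p) ≠ 0. -/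
open Real

/-- Fundamental theorem of calculus for a function given as the integral of a continuous one. -/
theorem hasDerivAt_of_eq_intervalIntegral {f g : ℝ → ℝ} (hg : Continuous g)
    (hf : ∀ t, f t = ∫ u in (0:ℝ)..t, g u) (t : ℝ) : HasDerivAt f (g t) t := by
  rw [funext hf]
  exact hg.integral_hasStrictDerivAt 0 t |>.hasDerivAt

/-- A curve rotated by a varying angle, at a critical point of the curve. -/
theorem HasDerivAt.rot {θ : ℝ → ℝ} {V : ℝ → ℝ × ℝ} {θ' p : ℝ}
    (hθ : HasDerivAt θ θ' p) (hV : HasDerivAt V 0 p) :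
    HasDerivAt (fun t => rot (θ t) (V t)) (θ' • rot (θ p + Real.pi / 2) (V p)) p := by
  have h₁ : HasDerivAt (fun t => (V t).1) 0 p := hV.fst
  have h₂ : HasDerivAt (fun t => (V t).2) 0 p := hV.snd
  refine (((hθ.cos.mul h₁).sub (hθ.sin.mul h₂)).prodMk
    ((hθ.sin.mul h₁).add (hθ.cos.mul h₂))).congr_deriv ?_
  ext <;> simp [_root_.rot, Real.cos_add_pi_div_two, Real.sin_add_pi_div_two] <;> ring

/-- Rotations preserve the sum of squares of the coordinates. -/
theorem rot_fst_sq_add_snd_sq (θ : ℝ) (v : ℝ × ℝ) :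
    (rot θ v).1 ^ 2 + (rot θ v).2 ^ 2 = v.1 ^ 2 + v.2 ^ 2 := by
  simp only [rot]
  linear_combination (v.1 ^ 2 + v.2 ^ 2) * Real.sin_sq_add_cos_sq θ

/-- At a singular point `p` (i.e. `l p = 0`), the frontal `γ` is a front
(`n'(p) ≠ 0`) if and only if `η'(p) ≠ 0`, equivalently `h p ≠ 0`. -/
theorem front_iff_eta_deriv_ne_zero
    (l h : ℝ → ℝ) (hl : ContDiff ℝ (⊤ : ℕ∞) l) (hh : ContDiff ℝ (⊤ : ℕ∞) h)
    (η F G : ℝ → ℝ)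
    (hη : ∀ u, η u = ∫ v in (0:ℝ)..u, 2 * h v)
    (hF : ∀ t, F t = ∫ u in (0:ℝ)..t, l u * sin (η u))
    (hG : ∀ t, G t = ∫ u in (0:ℝ)..t, l u * cos (η u))
    (c₁ c₂ : ℝ)
    (hpos : ∀ t, 0 < (F t - c₁) ^ 2 + (G t - c₂) ^ 2)
    (y x : ℝ → ℝ)
    (hy : ∀ t, y t = Real.sqrt ((F t - c₁) ^ 2 + (G t - c₂) ^ 2))
    (hx : ∀ t, x t = ∫ u in (0:ℝ)..t,
      (deriv F u * (G u - c₂) - deriv G u * (F u - c₁)) / y u)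
    (γ : ℝ → ℝ × ℝ) (hγ : ∀ t, γ t = (x t, y t))
    (U : ℝ → ℝ × ℝ) (hU : ∀ t, U t = (-(F t - c₁), G t - c₂))
    (n : ℝ → ℝ × ℝ)
    (hn : ∀ t, n t = (1 / Real.sqrt ((U t).1 ^ 2 + (U t).2 ^ 2)) •
      rot (-(η t) + Real.pi / 2) (U t))
    (p : ℝ) (hlp : l p = 0) :
    (deriv n p ≠ 0 ↔ deriv η p ≠ 0) ∧ (deriv η p ≠ 0 ↔ h p ≠ 0) := by
  have hη' : ∀ t, HasDerivAt η (2 * h t) t :=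
    hasDerivAt_of_eq_intervalIntegral (continuous_const.mul hh.continuous) hη
  have hηc : Continuous η := continuous_iff_continuousAt.2 fun t => (hη' t).continuousAt
  have hF' : HasDerivAt F 0 p := by
    simpa [hlp] using hasDerivAt_of_eq_intervalIntegral
      (hl.continuous.mul (Real.continuous_sin.comp hηc)) hF p
  have hG' : HasDerivAt G 0 p := by
    simpa [hlp] using hasDerivAt_of_eq_intervalIntegral
      (hl.continuous.mul (Real.continuous_cos.comp hηc)) hG p
  have hU' : HasDerivAt U 0 p := by
    rw [funext hU]
    exact ((hF'.sub_const c₁).neg.prodMk (hG'.sub_const c₂)).congr_deriv (by simp)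
  have hUpos : 0 < (U p).1 ^ 2 + (U p).2 ^ 2 := by simpa only [hU, neg_sq] using hpos p
  have hU₁ : HasDerivAt (fun t => (U t).1) 0 p := hU'.fst
  have hU₂ : HasDerivAt (fun t => (U t).2) 0 p := hU'.snd
  have hscale : HasDerivAt (fun t => 1 / Real.sqrt ((U t).1 ^ 2 + (U t).2 ^ 2)) 0 p := by
    have hnorm : HasDerivAt (fun t => (U t).1 ^ 2 + (U t).2 ^ 2) 0 p :=
      ((hU₁.pow 2).add (hU₂.pow 2)).congr_deriv (by simp)
    simpa using (hnorm.sqrt hUpos.ne').fun_inv (Real.sqrt_pos.2 hUpos).ne'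
  have hn' : HasDerivAt n ((1 / Real.sqrt ((U p).1 ^ 2 + (U p).2 ^ 2)) •
      (-(2 * h p)) • rot (-(η p) + Real.pi / 2 + Real.pi / 2) (U p)) p := by
    rw [funext hn]
    simpa using hscale.fun_smul (((hη' p).neg.add_const (Real.pi / 2)).rot hU')
  have hrot : rot (-(η p) + Real.pi / 2 + Real.pi / 2) (U p) ≠ 0 := by
    intro h0
    have hsq := rot_fst_sq_add_snd_sq (-(η p) + Real.pi / 2 + Real.pi / 2) (U p)
    rw [h0] at hsq
    simp at hsq
    linarith
  rw [hn'.deriv, (hη' p).deriv]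
  have hk : 1 / Real.sqrt ((U p).1 ^ 2 + (U p).2 ^ 2) ≠ 0 :=
    one_div_ne_zero (Real.sqrt_pos.2 hUpos).ne'
  constructor
  · rw [ne_eq, smul_eq_zero_iff_right hk, smul_eq_zero_iff_left hrot, neg_eq_zero]
  · simp
end

section
/- Suppose l and h are periodic with period L > 0. Then for all u, t ∈ ℝ: η(u + L) = η(u) + η(L), F(t + L) = F(L) + sin η(L)·G(t) + cos η(L)·F(t), and G(t + L) = G(L) + cos η(L)·G(t) − sin η(L)·F(t). -/
open Real

/-- Splitting `∫₀^{t+L} f` at `L` and shifting the second piece back to `[0, t]`. -/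
theorem integral_zero_add_eq_add_integral_shift {f : ℝ → ℝ} (hf : Continuous f) (t L : ℝ) :
    ∫ u in (0:ℝ)..(t + L), f u = (∫ u in (0:ℝ)..L, f u) + ∫ u in (0:ℝ)..t, f (u + L) := by
  rw [intervalIntegral.integral_comp_add_right, zero_add,
    intervalIntegral.integral_add_adjacent_intervals (hf.intervalIntegrable _ _)
      (hf.intervalIntegrable _ _)]

/-- Quasi-periodicity of `η`, `F`, `G` when `l` and `h` are `L`-periodic. -/
theorem eta_F_G_quasi_periodic
    (l h : ℝ → ℝ) (hl : ContDiff ℝ (⊤ : ℕ∞) l) (hh : ContDiff ℝ (⊤ : ℕ∞) h)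
    (η F G : ℝ → ℝ)
    (hη : ∀ u, η u = ∫ v in (0:ℝ)..u, 2 * h v)
    (hF : ∀ t, F t = ∫ u in (0:ℝ)..t, l u * sin (η u))
    (hG : ∀ t, G t = ∫ u in (0:ℝ)..t, l u * cos (η u))
    (L : ℝ) (hL : 0 < L)
    (hlper : ∀ t, l (t + L) = l t) (hhper : ∀ t, h (t + L) = h t)
    :
    (∀ u, η (u + L) = η u + η L) ∧
    (∀ t, F (t + L) = F L + sin (η L) * G t + cos (η L) * F t) ∧
    (∀ t, G (t + L) = G L + cos (η L) * G t - sin (η L) * F t) := by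
  have hlc : Continuous l := hl.continuous
  have hhc : Continuous fun v => 2 * h v := continuous_const.mul hh.continuous
  have hηc : Continuous η := by
    rw [funext hη]
    exact intervalIntegral.continuous_primitive (fun a b => hhc.intervalIntegrable a b) 0
  have hs : Continuous fun u => l u * sin (η u) := by fun_prop
  have hc : Continuous fun u => l u * cos (η u) := by fun_prop
  have hηL : ∀ u, η (u + L) = η u + η L := fun u => by
    rw [hη (u + L), integral_zero_add_eq_add_integral_shift hhc, hη u, hη L]
    simp only [hhper]
    ring
  refine ⟨hηL, fun t => ?_, fun t => ?_⟩
  · rw [hF (t + L), integral_zero_add_eq_add_integral_shift hs, ← hF L, hG t, hF t, add_assoc,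
      ← intervalIntegral.integral_const_mul, ← intervalIntegral.integral_const_mul,
      ← intervalIntegral.integral_add ((hc.const_mul _).intervalIntegrable _ _)
        ((hs.const_mul _).intervalIntegrable _ _)]
    congr 2 with u
    rw [hlper, hηL, sin_add]
    ring
  · rw [hG (t + L), integral_zero_add_eq_add_integral_shift hc, ← hG L, hG t, hF t, add_sub_assoc,
      ← intervalIntegral.integral_const_mul, ← intervalIntegral.integral_const_mul,
      ← intervalIntegral.integral_sub ((hc.const_mul _).intervalIntegrable _ _)
        ((hs.const_mul _).intervalIntegrable _ _)]
    congr 2 with u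
    rw [hlper, hηL, cos_add]
    ring
end
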